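/- (Correctness of linear RTO sampling.) Let M be a real p × n matrix with trivial kernel and b₀ ∈ ℝᵖ. If z is a standard Gaussian random vector on ℝᵖ (mean 0, identity covariance), then the random vector x' = (MᵀM)⁻¹Mᵀ(b₀ + z) — i.e., the least-squares solution of min_x ‖Mx − (b₀ + z)‖₂² — has the multivariate Gaussian distribution on ℝⁿ with mean (MᵀM)⁻¹Mᵀb₀ and covariance matrix (MᵀM)⁻¹. Equivalently, the pushforward of the standard Gaussian measure on ℝᵖ under the affine map z ↦ (MᵀM)⁻¹Mᵀ(b₀ + z) is the Gaussian measure with mean (MᵀM)⁻¹Mᵀb₀ and covariance (MᵀM)⁻¹. -/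

import Mathlib

open Matrix MeasureTheory

/-- The multivariate Gaussian measure on `ℝⁿ` with mean `m` and (positive definite)
covariance matrix `S`: the Borel measure with Lebesgue density
`((2π)ⁿ det S)^{-1/2} exp(−½ (x − m)ᵀ S⁻¹ (x − m))`. -/
noncomputable def gaussianMeasure {n : ℕ} (m : Fin n → ℝ) (S : Matrix (Fin n) (Fin n) ℝ) :
    Measure (Fin n → ℝ) :=
  volume.withDensity fun x =>
    ENNReal.ofReal (((2 * Real.pi) ^ n * S.det) ^ (-(1 : ℝ) / 2) *
      Real.exp (-(1 / 2) * ((x - m) ⬝ᵥ S⁻¹ *ᵥ (x - m))))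

lemma gm_std (p : ℕ) : gaussianMeasure (0 : Fin p → ℝ) (1 : Matrix (Fin p) (Fin p) ℝ) =
    Measure.pi (fun _ : Fin p => ProbabilityTheory.gaussianReal 0 1) := by
  symm
  apply Measure.pi_eq
  intro s hs
  unfold gaussianMeasure
  rw [withDensity_apply _ (MeasurableSet.univ_pi hs)]
  have h1 : ∀ x : Fin p → ℝ, ((2 * Real.pi) ^ p * (1 : Matrix (Fin p) (Fin p) ℝ).det) ^ (-(1 : ℝ) / 2) *
      Real.exp (-(1 / 2) * ((x - 0) ⬝ᵥ (1 : Matrix (Fin p) (Fin p) ℝ)⁻¹ *ᵥ (x - 0)))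
      = ∏ i, ProbabilityTheory.gaussianPDFReal 0 1 (x i) := by
    intro x
    simp only [ProbabilityTheory.gaussianPDFReal_def, Finset.prod_mul_distrib, ← Real.exp_sum]
    simp only [det_one, mul_one, sub_zero, inv_one, one_mulVec, NNReal.coe_one, Finset.prod_const,
      Finset.card_univ, Fintype.card_fin]
    congr 1
    · rw [Real.sqrt_eq_rpow, ← Real.rpow_natCast, ← Real.rpow_neg (by positivity),
        ← Real.rpow_natCast, ← Real.rpow_mul (by positivity), ← Real.rpow_mul (by positivity)]
      ring_nf
    · congr 1
      rw [dotProduct, Finset.mul_sum]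
      refine Finset.sum_congr rfl fun i _ => ?_
      ring
  simp_rw [h1]
  rw [volume_pi, Measure.restrict_pi_pi]
  have hint : ∀ i, Integrable (ProbabilityTheory.gaussianPDFReal 0 1) (volume.restrict (s i)) :=
    fun i => (ProbabilityTheory.integrable_gaussianPDFReal 0 1).restrict
  have hnn := ProbabilityTheory.gaussianPDFReal_nonneg 0 1
  rw [← ofReal_integral_eq_lintegral_ofReal]
  · rw [integral_fintype_prod_eq_prod (f := fun _ x => ProbabilityTheory.gaussianPDFReal 0 1 x),
      ENNReal.ofReal_prod_of_nonneg]
    · refine Finset.prod_congr rfl fun i _ => ?_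
      rw [ProbabilityTheory.gaussianReal_apply_eq_integral 0 one_ne_zero]
    · intro i _
      exact integral_nonneg hnn
  · exact Integrable.fintype_prod (f := fun _ x => ProbabilityTheory.gaussianPDFReal 0 1 x) hint
  · exact ae_of_all _ fun x => Finset.prod_nonneg fun i _ => hnn _

lemma gm_affine {n : ℕ} (m : Fin n → ℝ) (B : Matrix (Fin n) (Fin n) ℝ) (hB : B.det ≠ 0) :
    Measure.map (fun z => m + B *ᵥ z) (gaussianMeasure 0 1) = gaussianMeasure m (B * Bᵀ) := by
  have hf : Measurable (fun z : Fin n → ℝ => m + B *ᵥ z) := by fun_prop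
  have hvol : (volume : Measure (Fin n → ℝ)) =
      ENNReal.ofReal |B.det| • Measure.map (fun z => m + B *ᵥ z) volume := by
    have h := Real.map_matrix_volume_pi_eq_smul_volume_pi hB
    have h2 : Measure.map (fun z : Fin n → ℝ => m + B *ᵥ z) volume =
        Measure.map (fun z => m + z) (Measure.map (toLin' B) volume) := by
      rw [Measure.map_map (by fun_prop)]
      · rfl
      · exact (LinearMap.continuous_of_finiteDimensional _).measurable
    rw [h2, h, Measure.map_smul, map_add_left_eq_self, smul_smul,
      ← ENNReal.ofReal_mul (abs_nonneg _), ← abs_mul, mul_inv_cancel₀ hB]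
    simp
  ext s hs
  rw [Measure.map_apply hf hs]
  unfold gaussianMeasure
  rw [withDensity_apply _ (hf hs), withDensity_apply _ hs]
  conv_rhs => rw [hvol]
  rw [Measure.restrict_smul, lintegral_smul_measure,
    setLIntegral_map hs (by unfold dotProduct; fun_prop) hf, smul_eq_mul,
    ← lintegral_const_mul _ (by unfold dotProduct; fun_prop)]
  refine lintegral_congr fun z => ?_
  rw [← ENNReal.ofReal_mul (abs_nonneg _), ← mul_assoc]
  congr 2
  · have hp : 0 < |B.det| := abs_pos.mpr hB
    rw [det_mul, det_transpose, ← abs_mul_abs_self B.det, det_one, mul_one,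
      Real.mul_rpow (by positivity) (by positivity), ← pow_two, ← Real.rpow_natCast |B.det|, ← Real.rpow_mul hp.le]
    norm_num
    rw [Real.rpow_neg_one]
    field_simp
  · have hu : IsUnit B.det := isUnit_iff_ne_zero.mpr hB
    congr 2
    simp only [sub_zero, inv_one, one_mulVec, add_sub_cancel_left, Matrix.mul_inv_rev]
    rw [mulVec_mulVec, Matrix.mul_assoc, nonsing_inv_mul _ hu, Matrix.mul_one, dotProduct_mulVec,
      ← vecMul_transpose, vecMul_vecMul, mul_nonsing_inv _ (by simpa using hu), vecMul_one]

lemma charFun_pi_lin {p n : ℕ} (A : Matrix (Fin n) (Fin p) ℝ) (L : StrongDual ℝ (Fin n → ℝ)) :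
    charFunDual (Measure.map (fun z => A *ᵥ z)
      (Measure.pi (fun _ : Fin p => ProbabilityTheory.gaussianReal 0 1))) L =
    Complex.exp (-(((fun i => L (Pi.single i 1)) ⬝ᵥ
      (A * Aᵀ) *ᵥ (fun i => L (Pi.single i 1)) : ℝ) : ℂ) / 2) := by
  have hA : (fun z => A *ᵥ z) = (toLin' A).toContinuousLinearMap := by ext; simp
  have hL : ∀ v, L v = (fun i => L (Pi.single i 1)) ⬝ᵥ v := by
    intro v
    have h := LinearMap.pi_apply_eq_sum_univ (L : (Fin n → ℝ) →ₗ[ℝ] ℝ) v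
    simp only [ContinuousLinearMap.coe_coe, smul_eq_mul] at h
    rw [h, dotProduct]
    refine Finset.sum_congr rfl fun i _ => ?_
    rw [mul_comm]
    congr 2
    ext j
    simp [Pi.single_apply, eq_comm]
  have hg : ∀ L' : StrongDual ℝ ℝ, charFunDual (ProbabilityTheory.gaussianReal 0 1) L' =
      Complex.exp (-((L' 1 ^ 2 : ℝ) : ℂ) / 2) := by
    intro L'
    have h := ProbabilityTheory.charFun_gaussianReal (μ := 0) (v := 1) (L' 1)
    rw [charFun_apply_real] at h
    rw [charFunDual_apply]
    have h2 : ∀ v : ℝ, ((L' v : ℝ) : ℂ) = ((L' 1 : ℝ) : ℂ) * (v : ℂ) := by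
      intro v
      have : L' v = L' 1 * v := by
        have := L'.map_smul v 1
        simp only [smul_eq_mul, mul_one] at this
        rw [this, mul_comm]
      rw [this]
      push_cast
      rfl
    rw [integral_congr_ae (ae_of_all _ fun v => by rw [h2 v]), h]
    congr 1
    simp
    ring
  rw [hA, charFunDual_map, charFunDual_pi]
  simp_rw [hg]
  rw [← Complex.exp_sum, ← Finset.sum_div, Finset.sum_neg_distrib, ← Complex.ofReal_sum]
  congr 4
  rw [← mulVec_mulVec, dotProduct_mulVec, mulVec_transpose, dotProduct]
  refine Finset.sum_congr rfl fun i _ => ?_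
  have : (L.comp (toLin' A).toContinuousLinearMap).comp
      (ContinuousLinearMap.single ℝ (fun _ : Fin p => ℝ) i) 1 =
      ((fun i => L (Pi.single i 1)) ᵥ* A) i := by
    simp only [ContinuousLinearMap.comp_apply, ContinuousLinearMap.single_apply,
      LinearMap.coe_toContinuousLinearMap', toLin'_apply]
    rw [hL, dotProduct_mulVec, dotProduct_single, mul_one]
  rw [this, pow_two]

lemma map_lin_eq {p q n : ℕ} (A : Matrix (Fin n) (Fin p) ℝ) (B : Matrix (Fin n) (Fin q) ℝ)
    (h : A * Aᵀ = B * Bᵀ) :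
    Measure.map (fun z => A *ᵥ z) (gaussianMeasure 0 1) =
    Measure.map (fun z => B *ᵥ z) (gaussianMeasure 0 1) := by
  rw [gm_std, gm_std]
  have : IsProbabilityMeasure (Measure.map (fun z => A *ᵥ z)
      (Measure.pi (fun _ : Fin p => ProbabilityTheory.gaussianReal 0 1))) :=
    Measure.isProbabilityMeasure_map (by fun_prop)
  have : IsProbabilityMeasure (Measure.map (fun z => B *ᵥ z)
      (Measure.pi (fun _ : Fin q => ProbabilityTheory.gaussianReal 0 1))) :=
    Measure.isProbabilityMeasure_map (by fun_prop)
  apply Measure.ext_of_charFunDual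
  ext L
  rw [charFun_pi_lin, charFun_pi_lin, h]

open scoped MatrixOrder in
lemma exists_factor {p n : ℕ} (M : Matrix (Fin p) (Fin n) ℝ) :
    ∃ C : Matrix (Fin n) (Fin n) ℝ, Mᵀ * M = Cᵀ * C := by
  have h : (Mᵀ * M).PosSemidef := by
    simpa using posSemidef_conjTranspose_mul_self M
  obtain ⟨C, hC⟩ := CStarAlgebra.nonneg_iff_eq_star_mul_self.mp h.nonneg
  exact ⟨C, by simpa [star_eq_conjTranspose] using hC⟩

/-- Correctness of linear RTO sampling: if `M` has trivial kernel and `z` is standard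
Gaussian on `ℝᵖ`, then the least-squares solution `x' = (MᵀM)⁻¹Mᵀ(b₀ + z)` is Gaussian
with mean `(MᵀM)⁻¹Mᵀb₀` and covariance `(MᵀM)⁻¹`; i.e. the pushforward of the standard
Gaussian under `z ↦ (MᵀM)⁻¹Mᵀ(b₀ + z)` is that Gaussian measure. -/
theorem stmt_9 {p n : ℕ} (M : Matrix (Fin p) (Fin n) ℝ)
    (hM : ∀ x : Fin n → ℝ, M *ᵥ x = 0 → x = 0) (b₀ : Fin p → ℝ) :
    Measure.map (fun z : Fin p → ℝ => ((Mᵀ * M)⁻¹ * Mᵀ) *ᵥ (b₀ + z))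
        (gaussianMeasure (0 : Fin p → ℝ) (1 : Matrix (Fin p) (Fin p) ℝ)) =
      gaussianMeasure ((Mᵀ * M)⁻¹ *ᵥ (Mᵀ *ᵥ b₀)) (Mᵀ * M)⁻¹ := by
  obtain ⟨C, hC⟩ := exists_factor M
  have hdet : (Mᵀ * M).det ≠ 0 := by
    intro h0
    obtain ⟨v, hv, hv0⟩ := exists_mulVec_eq_zero_iff.mpr h0
    apply hv
    apply hM
    rw [← dotProduct_self_eq_zero, dotProduct_mulVec, ← vecMul_transpose, vecMul_vecMul,
      ← dotProduct_mulVec, hv0, dotProduct_zero]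
  have hCd : C.det ≠ 0 := by
    intro h0
    apply hdet
    rw [hC, det_mul, h0, mul_zero]
  have hu : IsUnit (Mᵀ * M).det := isUnit_iff_ne_zero.mpr hdet
  have hBB : C⁻¹ * C⁻¹ᵀ = (Mᵀ * M)⁻¹ := by
    rw [hC, Matrix.mul_inv_rev, transpose_nonsing_inv]
  have hKK : ((Mᵀ * M)⁻¹ * Mᵀ) * ((Mᵀ * M)⁻¹ * Mᵀ)ᵀ = (Mᵀ * M)⁻¹ := by
    rw [transpose_mul, transpose_transpose, transpose_nonsing_inv, transpose_mul,
      transpose_transpose, Matrix.mul_assoc, ← Matrix.mul_assoc Mᵀ, mul_nonsing_inv _ hu,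
      Matrix.mul_one]
  have hBd : (C⁻¹).det ≠ 0 := by
    rw [det_nonsing_inv]
    simpa using hCd
  rw [← hBB, ← gm_affine _ _ hBd, hBB]
  have e := map_lin_eq ((Mᵀ * M)⁻¹ * Mᵀ) C⁻¹ (hKK.trans hBB.symm)
  have e2 := congrArg (Measure.map (fun x => (Mᵀ * M)⁻¹ *ᵥ (Mᵀ *ᵥ b₀) + x)) e
  rw [Measure.map_map (by fun_prop) (by fun_prop), Measure.map_map (by fun_prop) (by fun_prop)] at e2
  simpa only [Function.comp_def, mulVec_add, mulVec_mulVec] using e2
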